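/- Let v₁ and v₂ be bounded solutions of the ODE (O6). If v₁(0) = v₂(0) and v₁'(0) = v₂'(0), then v₁(t) = v₂(t) for all t ∈ ℝ. In other words, a bounded entire solution of (O6) is uniquely determined by the two initial values v(0) and v'(0). -/

import Mathlib

noncomputable section

open Real

def cN (n : ℕ) : ℝ := (n : ℝ) * ((n : ℝ) - 6) * ((n : ℝ) ^ 4 - 20 * (n : ℝ) ^ 2 + 64) / 64
def K0 (n : ℕ) : ℝ := ((n : ℝ) - 6) ^ 2 * ((n : ℝ) - 2) ^ 2 * ((n : ℝ) + 2) ^ 2 / 64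
def K2 (n : ℕ) : ℝ := (3 * (n : ℝ) ^ 4 - 24 * (n : ℝ) ^ 3 + 72 * (n : ℝ) ^ 2 - 96 * (n : ℝ) + 304) / 16
def K4 (n : ℕ) : ℝ := (3 * (n : ℝ) ^ 2 - 12 * (n : ℝ) + 44) / 4

/-- `v` is a (classical, entire) solution of the sixth order ODE (O6). -/
def IsSolO6 (n : ℕ) (v : ℝ → ℝ) : Prop :=
  ContDiff ℝ 6 v ∧ ∀ t : ℝ,
    iteratedDeriv 6 v t - K4 n * iteratedDeriv 4 v t + K2 n * iteratedDeriv 2 v t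
      - K0 n * v t + cN n * |v t| ^ (12 / ((n : ℝ) - 6)) * v t = 0

/-- Integrated form of `u' = β u + g` after the substitution `u = exp (κ t) z`, bounded below. -/
lemma mul_sub_le_exp_mul_sub {β κ B p r : ℝ} {u g : ℝ → ℝ}
    (h : ∀ t, HasDerivAt u (β * u t + g t) t) (hpr : p ≤ r)
    (hB : ∀ t ∈ Set.Icc p r, B ≤ exp (-κ * t) * ((β - κ) * u t + g t)) :
    B * (r - p) ≤ exp (-κ * r) * u r - exp (-κ * p) * u p := by
  have hd : ∀ t, HasDerivAt (fun t => exp (-κ * t) * u t)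
      (exp (-κ * t) * ((β - κ) * u t + g t)) t := by
    intro t
    have h1 : HasDerivAt (fun t : ℝ => exp (-κ * t)) (exp (-κ * t) * (-κ * 1)) t :=
      ((hasDerivAt_id t).const_mul (-κ)).exp
    exact (h1.mul (h t)).congr_deriv (by ring)
  refine (convex_Icc p r).mul_sub_le_image_sub_of_le_deriv
    (fun t _ => (hd t).continuousAt.continuousWithinAt)
    (fun t _ => (hd t).differentiableAt.differentiableWithinAt) (fun t ht => ?_)
    p (Set.left_mem_Icc.2 hpr) r (Set.right_mem_Icc.2 hpr) hpr
  rw [(hd t).deriv]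
  exact hB t (interior_subset ht)

/-- Integrated form of `u' = β u + g` after the substitution `u = exp (κ t) z`, bounded above. -/
lemma exp_mul_sub_le_mul_sub {β κ B p r : ℝ} {u g : ℝ → ℝ}
    (h : ∀ t, HasDerivAt u (β * u t + g t) t) (hpr : p ≤ r)
    (hB : ∀ t ∈ Set.Icc p r, exp (-κ * t) * ((β - κ) * u t + g t) ≤ B) :
    exp (-κ * r) * u r - exp (-κ * p) * u p ≤ B * (r - p) := by
  have h' : ∀ t, HasDerivAt (fun t => -u t) (β * (-u t) + (-g t)) t := fun t =>
    (h t).neg.congr_deriv (by ring)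
  have := mul_sub_le_exp_mul_sub (κ := κ) (B := -B) h' hpr
    (fun t ht => by have := hB t ht; linarith)
  linarith

lemma exp_mul_le_exp_mul {β κ p r : ℝ} {u g : ℝ → ℝ}
    (h : ∀ t, HasDerivAt u (β * u t + g t) t) (hpr : p ≤ r)
    (hB : ∀ t ∈ Set.Icc p r, 0 ≤ (β - κ) * u t + g t) :
    exp (-κ * p) * u p ≤ exp (-κ * r) * u r := by
  have := mul_sub_le_exp_mul_sub (κ := κ) (B := 0) h hpr
    (fun t ht => mul_nonneg (exp_pos _).le (hB t ht))
  linarith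

lemma exp_mul_le_exp_mul_of_nonpos {β κ p r : ℝ} {u g : ℝ → ℝ}
    (h : ∀ t, HasDerivAt u (β * u t + g t) t) (hpr : p ≤ r)
    (hB : ∀ t ∈ Set.Icc p r, (β - κ) * u t + g t ≤ 0) :
    exp (-κ * r) * u r ≤ exp (-κ * p) * u p := by
  have := exp_mul_sub_le_mul_sub (κ := κ) (B := 0) h hpr
    (fun t ht => mul_nonpos_of_nonneg_of_nonpos (exp_pos _).le (hB t ht))
  linarith

lemma antitone_of_nonpos {β p r : ℝ} {u g : ℝ → ℝ} (hβ : 0 ≤ β)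
    (h : ∀ t, HasDerivAt u (β * u t + g t) t) (hpr : p ≤ r)
    (hu : ∀ t ∈ Set.Icc p r, u t ≤ 0) (hg : ∀ t ∈ Set.Icc p r, g t ≤ 0) : u r ≤ u p := by
  have := exp_mul_le_exp_mul_of_nonpos (κ := 0) h hpr
    (fun t ht => by nlinarith [hu t ht, hg t ht])
  simpa using this

/-- A positive source keeps a nonnegative solution of `u' = β u + g` strictly positive. -/
lemma pos_of_source_pos {β p r : ℝ} {u g : ℝ → ℝ}
    (h : ∀ t, HasDerivAt u (β * u t + g t) t) (hpr : p < r)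
    (hu : 0 ≤ u p) (hg : ∀ t ∈ Set.Ioo p r, 0 < g t) : 0 < u r := by
  have hd : ∀ t, HasDerivAt (fun t => exp (-β * t) * u t) (exp (-β * t) * g t) t := by
    intro t
    have h1 : HasDerivAt (fun t : ℝ => exp (-β * t)) (exp (-β * t) * (-β * 1)) t :=
      ((hasDerivAt_id t).const_mul (-β)).exp
    exact (h1.mul (h t)).congr_deriv (by ring)
  have hs : StrictMonoOn (fun t => exp (-β * t) * u t) (Set.Icc p r) := by
    refine strictMonoOn_of_deriv_pos (convex_Icc p r)
      (fun t _ => (hd t).continuousAt.continuousWithinAt) (fun t ht => ?_)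
    rw [interior_Icc] at ht
    rw [(hd t).deriv]
    exact mul_pos (exp_pos _) (hg t ht)
  have h2 := hs (Set.left_mem_Icc.2 hpr.le) (Set.right_mem_Icc.2 hpr.le) hpr
  have h3 : 0 ≤ exp (-β * p) * u p := mul_nonneg (exp_pos _).le hu
  exact pos_of_mul_pos_right (h3.trans_lt h2) (exp_pos _).le

lemma neg_of_source_neg {β p r : ℝ} {u g : ℝ → ℝ}
    (h : ∀ t, HasDerivAt u (β * u t + g t) t) (hpr : p < r)
    (hu : u p ≤ 0) (hg : ∀ t ∈ Set.Ioo p r, g t < 0) : u r < 0 := by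
  have h' : ∀ t, HasDerivAt (fun t => -u t) (β * (-u t) + (-g t)) t := fun t =>
    (h t).neg.congr_deriv (by ring)
  have := pos_of_source_pos h' hpr (by linarith) (fun t ht => by have := hg t ht; linarith)
  linarith

/-- Amplitude growth across one half-oscillation of a chain `y₁ ← y₂ ← y₃ ← y₄ ← y₅` whose zeros
`p₄ < p₃ < p₂ < p₁ ≤ q₄ < q₃` rotate in the expanding direction. -/
lemma amplitude_growth {β₁ β₂ β₃ β₄ κ p₁ p₂ p₃ p₄ q₃ q₄ : ℝ} {y₁ y₂ y₃ y₄ y₅ : ℝ → ℝ}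
    (h₁ : ∀ t, HasDerivAt y₁ (β₁ * y₁ t + y₂ t) t)
    (h₂ : ∀ t, HasDerivAt y₂ (β₂ * y₂ t + y₃ t) t)
    (h₃ : ∀ t, HasDerivAt y₃ (β₃ * y₃ t + y₄ t) t)
    (h₄ : ∀ t, HasDerivAt y₄ (β₄ * y₄ t + y₅ t) t)
    (hβ₁ : κ ≤ β₁) (hβ₂ : |κ| ≤ β₂) (hβ₃ : |κ| ≤ β₃) (hβ₄ : -κ ≤ β₄)
    (h43 : p₄ < p₃) (h32 : p₃ < p₂) (h21 : p₂ < p₁) (h1q : p₁ ≤ q₄) (hq : q₄ < q₃)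
    (s₁ : ∀ t ∈ Set.Icc p₃ p₁, 0 ≤ y₁ t) (s₁' : ∀ t ∈ Set.Icc p₁ q₃, y₁ t ≤ 0)
    (s₂ : ∀ t ∈ Set.Icc p₃ p₂, 0 ≤ y₂ t) (s₂' : ∀ t ∈ Set.Icc p₂ q₃, y₂ t ≤ 0)
    (s₃ : ∀ t ∈ Set.Icc p₄ p₃, 0 ≤ y₃ t) (s₃' : ∀ t ∈ Set.Icc p₃ q₃, y₃ t ≤ 0)
    (s₄ : ∀ t ∈ Set.Icc p₄ q₄, y₄ t ≤ 0) (s₅ : ∀ t ∈ Set.Icc p₄ p₁, y₅ t ≤ 0) :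
    4 * (y₁ p₃ ^ 2 * y₂ p₃ * (y₃ p₄ / ((p₃ - p₄) * exp (κ * (p₃ - p₄)))) ^ 2) ≤
      (-y₁ q₃) ^ 2 * (-y₂ q₃) * (-y₃ q₄ / ((q₃ - q₄) * exp (κ * (q₃ - q₄)))) ^ 2 ∧
    y₃ p₄ / ((p₃ - p₄) * exp (κ * (p₃ - p₄))) ≤ -y₄ p₃ := by
  have hκ := le_abs_self κ
  have hκ' := neg_abs_le κ
  have hz₁ : y₁ p₁ = 0 := le_antisymm (s₁' _ ⟨le_rfl, by linarith⟩) (s₁ _ ⟨by linarith, le_rfl⟩)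
  have hz₂ : y₂ p₂ = 0 := le_antisymm (s₂' _ ⟨le_rfl, by linarith⟩) (s₂ _ ⟨by linarith, le_rfl⟩)
  have hz₃ : y₃ p₃ = 0 := le_antisymm (s₃' _ ⟨le_rfl, by linarith⟩) (s₃ _ ⟨by linarith, le_rfl⟩)
  have split : ∀ a b : ℝ, exp (-κ * a) = exp (-κ * b) * exp (-κ * (a - b)) := fun a b => by
    rw [← exp_add]; ring_nf
  have split' : ∀ a b : ℝ, exp (κ * a) = exp (κ * b) * exp (κ * (a - b)) := fun a b => by
    rw [← exp_add]; ring_nf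
  -- the first amplitude before and after
  have a₁ : y₁ p₃ ≤ (p₁ - p₂) * exp (-κ * (p₁ - p₃)) * (-y₂ p₁) := by
    have e₁ := exp_mul_le_exp_mul (κ := κ) h₁ h32.le (fun t ht => add_nonneg
      (mul_nonneg (by linarith) (s₁ t ⟨ht.1, by linarith [ht.2]⟩)) (s₂ t ht))
    have e₂ := mul_sub_le_exp_mul_sub (κ := κ) (B := exp (-κ * p₁) * y₂ p₁) h₁ h21.le
      (fun t ht => by
        have e₃ := exp_mul_le_exp_mul_of_nonpos (κ := κ) (p := t) h₂ ht.2 (fun r hr => by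
          have := s₂' r ⟨by linarith [ht.1, hr.1], by linarith [hr.2]⟩
          have := s₃' r ⟨by linarith [ht.1, hr.1], by linarith [hr.2]⟩
          nlinarith)
        have : 0 ≤ exp (-κ * t) * ((β₁ - κ) * y₁ t) := mul_nonneg (exp_pos _).le
          (mul_nonneg (by linarith) (s₁ t ⟨by linarith [ht.1], ht.2⟩))
        linarith)
    rw [hz₁, split p₁ p₃] at e₂
    refine le_of_mul_le_mul_left ?_ (exp_pos (-κ * p₃))
    linarith
  have a₁' : (q₃ - q₄) * exp (κ * (q₃ - q₄)) * (-y₂ p₁) ≤ -y₁ q₃ := by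
    have e₀ : y₂ q₄ ≤ y₂ p₁ := antitone_of_nonpos ((abs_nonneg κ).trans hβ₂) h₂ h1q
      (fun t ht => s₂' t ⟨by linarith [ht.1], by linarith [ht.2]⟩)
      (fun t ht => s₃' t ⟨by linarith [ht.1], by linarith [ht.2]⟩)
    have e₁ := exp_mul_sub_le_mul_sub (κ := κ) (B := exp (-κ * q₄) * y₂ q₄) h₁ hq.le
      (fun t ht => by
        have e₃ := exp_mul_le_exp_mul_of_nonpos (κ := κ) (r := t) h₂ ht.1 (fun r hr => by
          have := s₂' r ⟨by linarith [hr.1], by linarith [hr.2, ht.2]⟩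
          have := s₃' r ⟨by linarith [hr.1], by linarith [hr.2, ht.2]⟩
          nlinarith)
        have : exp (-κ * t) * ((β₁ - κ) * y₁ t) ≤ 0 :=
          mul_nonpos_of_nonneg_of_nonpos (exp_pos _).le (mul_nonpos_of_nonneg_of_nonpos
            (by linarith) (s₁' t ⟨by linarith [ht.1], ht.2⟩))
        linarith)
    have e₂ : exp (-κ * q₄) * y₁ q₄ ≤ 0 :=
      mul_nonpos_of_nonneg_of_nonpos (exp_pos _).le (s₁' _ ⟨h1q, hq.le⟩)
    have e₄ : exp (-κ * q₄) = exp (-κ * q₃) * exp (κ * (q₃ - q₄)) := by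
      rw [← exp_add]; ring_nf
    rw [e₄] at e₁ e₂
    have e₅ : 0 ≤ (q₃ - q₄) * exp (κ * (q₃ - q₄)) := mul_nonneg (by linarith) (exp_pos _).le
    have e₆ : (q₃ - q₄) * exp (κ * (q₃ - q₄)) * (-y₂ q₄) ≤ -y₁ q₃ := by
      refine le_of_mul_le_mul_left ?_ (exp_pos (-κ * q₃))
      linarith
    have := mul_le_mul_of_nonneg_left e₀ e₅
    linarith
  -- the second amplitude
  have m₃ : ∀ a b, p₃ ≤ a → a ≤ b → b ≤ q₄ → y₃ b ≤ y₃ a := fun a b ha hab hb =>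
    antitone_of_nonpos ((abs_nonneg κ).trans hβ₃) h₃ hab
      (fun t ht => s₃' t ⟨by linarith [ht.1], by linarith [ht.2]⟩)
      (fun t ht => s₄ t ⟨by linarith [ht.1], by linarith [ht.2]⟩)
  have hβ₂0 : 0 ≤ β₂ := (abs_nonneg κ).trans hβ₂
  have a₂ : y₂ p₃ ≤ (p₂ - p₃) * (-y₃ p₂) := by
    have e := mul_sub_le_exp_mul_sub (κ := 0) (B := y₃ p₂) h₂ h32.le (fun t ht => by
      have e₁ := m₃ t p₂ ht.1 ht.2 (by linarith)
      have e₂ := mul_nonneg hβ₂0 (s₂ t ht)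
      simp only [neg_zero, zero_mul, exp_zero, one_mul, sub_zero]
      linarith)
    simp only [neg_zero, zero_mul, exp_zero, one_mul, hz₂] at e
    linarith
  have a₂' : (p₁ - p₂) * (-y₃ p₂) ≤ -y₂ q₃ := by
    have e := exp_mul_sub_le_mul_sub (κ := 0) (B := y₃ p₂) h₂ h21.le (fun t ht => by
      have e₁ := m₃ p₂ t h32.le ht.1 (by linarith [ht.2])
      have e₂ := mul_nonpos_of_nonneg_of_nonpos hβ₂0
        (s₂' t ⟨ht.1, by linarith [ht.2]⟩)
      simp only [neg_zero, zero_mul, exp_zero, one_mul, sub_zero]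
      linarith)
    simp only [neg_zero, zero_mul, exp_zero, one_mul, hz₂] at e
    have e₂ : y₂ q₃ ≤ y₂ p₁ := antitone_of_nonpos hβ₂0 h₂ (by linarith)
      (fun t ht => s₂' t ⟨by linarith [ht.1], ht.2⟩)
      (fun t ht => s₃' t ⟨by linarith [ht.1], ht.2⟩)
    linarith
  -- the third amplitude
  have m₄ : ∀ a b, p₄ ≤ a → a ≤ b → b ≤ p₁ → exp (κ * b) * y₄ b ≤ exp (κ * a) * y₄ a :=
    fun a b ha hab hb => by
      have := exp_mul_le_exp_mul_of_nonpos (κ := -κ) h₄ hab (fun t ht => by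
        have := s₄ t ⟨by linarith [ht.1], by linarith [ht.2]⟩
        have := s₅ t ⟨by linarith [ht.1], by linarith [ht.2]⟩
        nlinarith)
      simpa only [neg_neg] using this
  have a₃ : y₃ p₄ ≤ (p₃ - p₄) * exp (κ * (p₃ - p₄)) * (-y₄ p₃) := by
    have e := mul_sub_le_exp_mul_sub (κ := -κ) (B := exp (κ * p₃) * y₄ p₃) h₃ h43.le
      (fun t ht => by
        have e₁ := m₄ t p₃ ht.1 ht.2 (by linarith)
        have e₂ : 0 ≤ exp (κ * t) * ((β₃ - -κ) * y₃ t) := mul_nonneg (exp_pos _).le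
          (mul_nonneg (by linarith) (s₃ t ht))
        rw [neg_neg]
        linarith)
    rw [neg_neg, hz₃, split' p₃ p₄] at e
    refine le_of_mul_le_mul_left ?_ (exp_pos (κ * p₄))
    linarith
  have a₃' : (p₁ - p₃) * exp (-κ * (p₁ - p₃)) * (-y₄ p₃) ≤ -y₃ q₄ := by
    have e := exp_mul_sub_le_mul_sub (κ := -κ) (B := exp (κ * p₃) * y₄ p₃) h₃
      (h32.trans h21).le (fun t ht => by
        have e₁ := m₄ p₃ t h43.le ht.1 ht.2
        have e₂ : exp (κ * t) * ((β₃ - -κ) * y₃ t) ≤ 0 :=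
          mul_nonpos_of_nonneg_of_nonpos (exp_pos _).le
          (mul_nonpos_of_nonneg_of_nonpos (by linarith) (s₃' t ⟨ht.1, by linarith [ht.2]⟩))
        rw [neg_neg]
        linarith)
    have e₄ : exp (κ * p₃) = exp (κ * p₁) * exp (-κ * (p₁ - p₃)) := by
      rw [← exp_add]; ring_nf
    rw [neg_neg, hz₃, e₄] at e
    have e₅ := m₃ p₁ q₄ (by linarith) h1q le_rfl
    have e₆ : (p₁ - p₃) * exp (-κ * (p₁ - p₃)) * (-y₄ p₃) ≤ -y₃ p₁ := by
      refine le_of_mul_le_mul_left ?_ (exp_pos (κ * p₁))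
      linarith
    linarith
  have hp : 0 < (p₃ - p₄) * exp (κ * (p₃ - p₄)) := mul_pos (by linarith) (exp_pos _)
  have hq' : 0 < (q₃ - q₄) * exp (κ * (q₃ - q₄)) := mul_pos (by linarith) (exp_pos _)
  have b₃ : y₃ p₄ / ((p₃ - p₄) * exp (κ * (p₃ - p₄))) ≤ -y₄ p₃ :=
    (div_le_iff₀ hp).2 (by linarith)
  refine ⟨?_, b₃⟩
  set D := (q₃ - q₄) * exp (κ * (q₃ - q₄))
  set b := y₃ p₄ / ((p₃ - p₄) * exp (κ * (p₃ - p₄)))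
  set E := exp (-κ * (p₁ - p₃))
  have hE : 0 < E := exp_pos _
  have hx₂ : 0 ≤ -y₂ p₁ := by linarith [s₂' p₁ ⟨h21.le, by linarith⟩]
  have hx₃ : 0 ≤ -y₃ p₂ := by linarith [s₃' p₂ ⟨h32.le, by linarith⟩]
  have hx₄ : 0 ≤ -y₄ p₃ := by linarith [s₄ p₃ ⟨h43.le, by linarith⟩]
  have hy₁ : 0 ≤ y₁ p₃ := s₁ _ ⟨le_rfl, by linarith⟩
  have hy₂ : 0 ≤ y₂ p₃ := s₂ _ ⟨le_rfl, by linarith⟩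
  have hb : 0 ≤ b := div_nonneg (s₃ _ ⟨le_rfl, h43.le⟩) hp.le
  have hd₁ : 0 < p₁ - p₂ := by linarith
  have hd₂ : 0 < p₂ - p₃ := by linarith
  have key : (-y₂ p₁) * ((p₁ - p₃) * E * (-y₄ p₃)) ≤ -y₁ q₃ * (-y₃ q₄ / D) := by
    have e₁ : 0 ≤ (p₁ - p₃) * E * (-y₄ p₃) := by
      have : 0 < p₁ - p₃ := by linarith
      positivity
    calc (-y₂ p₁) * ((p₁ - p₃) * E * (-y₄ p₃))
        = (D * (-y₂ p₁)) * (((p₁ - p₃) * E * (-y₄ p₃)) / D) := by field_simp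
      _ ≤ -y₁ q₃ * (-y₃ q₄ / D) := by
          gcongr
          exact (mul_nonneg hq'.le hx₂).trans a₁'
  have lower : ((-y₂ p₁) * ((p₁ - p₃) * E * (-y₄ p₃))) ^ 2 * ((p₁ - p₂) * (-y₃ p₂)) ≤
      (-y₁ q₃ * (-y₃ q₄ / D)) ^ 2 * (-y₂ q₃) := by
    have : 0 < p₁ - p₃ := by linarith
    gcongr
  have upper : y₁ p₃ ^ 2 * y₂ p₃ * b ^ 2 ≤
      ((p₁ - p₂) * E * (-y₂ p₁)) ^ 2 * ((p₂ - p₃) * (-y₃ p₂)) * (-y₄ p₃) ^ 2 := by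
    gcongr
  have amgm : 4 * ((p₁ - p₂) * (p₂ - p₃)) ≤ (p₁ - p₃) ^ 2 := by
    nlinarith [sq_nonneg ((p₁ - p₂) - (p₂ - p₃))]
  have nn : 0 ≤ (p₁ - p₂) * E ^ 2 * (-y₂ p₁) ^ 2 * (-y₃ p₂) * (-y₄ p₃) ^ 2 := by positivity
  have := mul_le_mul_of_nonneg_left amgm nn
  calc 4 * (y₁ p₃ ^ 2 * y₂ p₃ * b ^ 2)
      ≤ 4 * (((p₁ - p₂) * E * (-y₂ p₁)) ^ 2 * ((p₂ - p₃) * (-y₃ p₂)) * (-y₄ p₃) ^ 2) := by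
        linarith
    _ ≤ ((-y₂ p₁) * ((p₁ - p₃) * E * (-y₄ p₃))) ^ 2 * ((p₁ - p₂) * (-y₃ p₂)) := by
        linarith
    _ ≤ (-y₁ q₃ * (-y₃ q₄ / D)) ^ 2 * (-y₂ q₃) := lower
    _ = (-y₁ q₃) ^ 2 * (-y₂ q₃) * (-y₃ q₄ / D) ^ 2 := by ring

/-- A factored sixth order equation written as a first order chain with a source `x 6` whose sign
is opposite to that of `x 0`. -/
structure FactorChain (α : ℕ → ℝ) (x : ℕ → ℝ → ℝ) : Prop where
  deriv : ∀ k < 6, ∀ t, HasDerivAt (x k) (α k * x k t + x (k + 1) t) t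
  neg : ∀ t, 0 < x 0 t → x 6 t < 0
  pos : ∀ t, x 0 t < 0 → 0 < x 6 t

lemma FactorChain.neg_chain {α : ℕ → ℝ} {x : ℕ → ℝ → ℝ} (hx : FactorChain α x) :
    FactorChain α (fun k t => -x k t) where
  deriv k hk t := (hx.deriv k hk t).neg.congr_deriv (by ring)
  neg t ht := by have := hx.pos t (by linarith); linarith
  pos t ht := by have := hx.neg t (by linarith); linarith

lemma FactorChain.reverse {α : ℕ → ℝ} {x : ℕ → ℝ → ℝ} (hx : FactorChain α x) :
    FactorChain (fun k => -α k) (fun k t => (-1) ^ k * x k (-t)) where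
  deriv k hk t := by
    have h := ((hx.deriv k hk (-t)).comp t (hasDerivAt_neg t)).const_mul ((-1 : ℝ) ^ k)
    exact h.congr_deriv (by rw [pow_succ]; ring)
  neg t ht := by
    have := hx.neg (-t) (by simpa using ht)
    norm_num
    exact this
  pos t ht := by
    have := hx.pos (-t) (by simpa using ht)
    norm_num
    exact this

/-- At time `s` the components up to `j` are nonnegative and the later ones nonpositive. -/
def OneSignChange (x : ℕ → ℝ → ℝ) (j : ℕ) (s : ℝ) : Prop :=
  (∀ k ≤ j, 0 ≤ x k s) ∧ ∀ k ≤ 5, j < k → x k s ≤ 0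

section Phase

variable {α : ℕ → ℝ} {x : ℕ → ℝ → ℝ} {s T C : ℝ} {j : ℕ}

/-- While `x 0` is positive every component changes sign at most once, from plus to minus, and
the later components do so before the earlier ones. -/
lemma FactorChain.phase (hx : FactorChain α x) {I : Set ℝ}
    (hI : ∀ t ∈ I, s < t ∧ Set.Ioo s t ⊆ I) (h0 : ∀ t ∈ I, 0 < x 0 t)
    (hs : OneSignChange x j s) (i : ℕ) : ∀ k, k + i = 6 → 1 ≤ k →
    (∀ t ∈ I, ∀ t' ∈ I, t < t' → x k t ≤ 0 → x k t' < 0) ∧ (j < k → ∀ t ∈ I, x k t < 0) ∧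
    (k ≤ 5 → ∀ t ∈ I, x k t ≤ 0 → x (k + 1) t ≤ 0) := by
  induction i with
  | zero =>
    intro k hk hk1
    obtain rfl : k = 6 := by omega
    exact ⟨fun t _ t' ht' _ _ => hx.neg t' (h0 t' ht'), fun _ t ht => hx.neg t (h0 t ht),
      fun h => by omega⟩
  | succ i ih =>
    intro k hk hk1
    obtain ⟨ih₁, ih₂, -⟩ := ih (k + 1) (by omega) (by omega)
    have hd := hx.deriv k (by omega)
    have hA : ∀ t ∈ I, x k t ≤ 0 → x (k + 1) t ≤ 0 := by
      intro t ht hkt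
      by_cases hj : j < k
      · exact (ih₂ (by omega) t ht).le
      · by_contra! hpos
        have := pos_of_source_pos hd (hI t ht).1 (hs.1 k (by omega)) (fun r hr => by
          by_contra! hr0
          exact absurd (ih₁ r ((hI t ht).2 hr) t ht hr.2 hr0) (by linarith))
        linarith
    refine ⟨fun t ht t' ht' htt hkt => ?_, fun hj t ht => ?_, fun _ => hA⟩
    · exact neg_of_source_neg hd htt hkt (fun r hr =>
        ih₁ t ht r ((hI t' ht').2 ⟨(hI t ht).1.trans hr.1, hr.2⟩) hr.1 (hA t ht hkt))
    · exact neg_of_source_neg hd (hI t ht).1 (hs.2 k (by omega) hj) (fun r hr =>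
        ih₂ (by omega) r ((hI t ht).2 hr))

lemma unbounded_of_source_nonpos {β p : ℝ} {u g : ℝ → ℝ} (hβ : 0 < β)
    (h : ∀ t, HasDerivAt u (β * u t + g t) t) (hu : u p < 0) (hg : ∀ t, p ≤ t → g t ≤ 0) :
    ∃ t, u t < -C := by
  by_contra! hb
  have key : ∀ r, p ≤ r → -u p * (β * (r - p)) ≤ C := by
    intro r hr
    have e := exp_mul_le_exp_mul_of_nonpos (κ := β) h hr (fun t ht => by
      simpa using hg t ht.1)
    have e₂ : exp (-β * p) = exp (-β * r) * exp (β * (r - p)) := by rw [← exp_add]; ring_nf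
    rw [e₂, mul_assoc] at e
    have e₃ := le_of_mul_le_mul_left e (exp_pos _)
    have e₄ := add_one_le_exp (β * (r - p))
    have := hb r
    nlinarith
  have h1 : 0 < -u p * β := mul_pos (by linarith) hβ
  have hC : 0 ≤ C := by have := key p le_rfl; simpa using this
  have h2 := key (p + (C + 1) / (-u p * β)) (by
    have : 0 ≤ (C + 1) / (-u p * β) := by positivity
    linarith)
  have h3 : -u p * (β * (p + (C + 1) / (-u p * β) - p)) = C + 1 := by
    have : -u p * (β * (p + (C + 1) / (-u p * β) - p)) =
      (-u p * β) * ((C + 1) / (-u p * β)) := by ring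
    rw [this, mul_div_cancel₀ _ h1.ne']
  linarith

lemma unbounded_of_source_nonneg {β p : ℝ} {u g : ℝ → ℝ} (hβ : 0 < β)
    (h : ∀ t, HasDerivAt u (β * u t + g t) t) (hu : 0 < u p) (hg : ∀ t, p ≤ t → 0 ≤ g t) :
    ∃ t, C < u t := by
  obtain ⟨t, ht⟩ := unbounded_of_source_nonpos (C := C) (u := fun t => -u t)
    (g := fun t => -g t) (p := p) hβ (fun t => (h t).neg.congr_deriv (by ring))
    (by linarith) (fun t ht => by linarith [hg t ht])
  exact ⟨t, by linarith⟩

/-- A bounded chain cannot stay positive forever if two consecutive rates are positive. -/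
lemma FactorChain.not_pos_forever (hx : FactorChain α x) (hs : OneSignChange x j s)
    (hb : ∀ k ≤ 5, ∀ t, |x k t| ≤ C) {i : ℕ} (hi : i ≤ 4) (hαi : 0 < α i)
    (hαi' : 0 < α (i + 1)) : ¬ ∀ t, s < t → 0 < x 0 t := by
  intro h0
  obtain ⟨hB, hN, hA⟩ := hx.phase (I := Set.Ioi s)
    (fun t ht => ⟨ht, fun r hr => hr.1⟩) h0 hs (5 - i) (i + 1) (by omega) (by omega)
  by_cases hex : ∃ t₀, s < t₀ ∧ x (i + 1) t₀ ≤ 0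
  · obtain ⟨t₀, hst, ht₀⟩ := hex
    have hneg : ∀ t, t₀ < t → x (i + 1) t < 0 := fun t ht =>
      hB t₀ hst t (hst.trans ht) ht ht₀
    obtain ⟨t, ht⟩ := unbounded_of_source_nonpos (C := C) hαi' (hx.deriv (i + 1) (by omega))
      (hneg (t₀ + 1) (by linarith)) (fun t ht =>
        hA (by omega) t (show s < t by linarith) (hneg t (by linarith)).le)
    linarith [neg_abs_le (x (i + 1) t), hb (i + 1) (by omega) t]
  · push Not at hex
    have hj : i + 1 ≤ j := by
      by_contra! hj
      linarith [hN hj (s + 1) (show s < s + 1 by linarith), hex (s + 1) (by linarith)]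
    have hp := pos_of_source_pos (hx.deriv i (by omega)) (show s < s + 1 by linarith)
      (hs.1 i (by omega)) (fun r hr => hex r hr.1)
    obtain ⟨t, ht⟩ := unbounded_of_source_nonneg (C := C) hαi (hx.deriv i (by omega)) hp
      (fun t ht => (hex t (by linarith)).le)
    linarith [le_abs_self (x i t), hb i (by omega) t]

lemma FactorChain.continuous (hx : FactorChain α x) {k : ℕ} (hk : k ≤ 5) : Continuous (x k) :=
  continuous_iff_continuousAt.2 fun t => (hx.deriv k (by omega) t).continuousAt

lemma FactorChain.exists_pos_right (hx : FactorChain α x) (m : ℕ) : ∀ i, i + m ≤ 5 →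
    0 < x (i + m) s → (∀ k < i + m, 0 ≤ x k s) →
    ∃ δ > 0, ∀ t ∈ Set.Ioo s (s + δ), 0 < x i t := by
  induction m with
  | zero =>
    intro i hi hp _
    have := (hx.continuous (k := i) (by omega)).continuousAt.eventually (lt_mem_nhds hp)
    obtain ⟨δ, hδ, h⟩ := Metric.eventually_nhds_iff.1 this
    refine ⟨δ, hδ, fun t ht => h ?_⟩
    rw [Real.dist_eq, abs_lt]
    constructor <;> linarith [ht.1, ht.2]
  | succ m ih =>
    intro i hi hp hk
    have e : i + 1 + m = i + (m + 1) := by omega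
    obtain ⟨δ, hδ, h⟩ := ih (i + 1) (by omega) (by rw [e]; exact hp)
      (fun k hk' => hk k (by omega))
    exact ⟨δ, hδ, fun t ht => pos_of_source_pos (hx.deriv i (by omega)) ht.1
      (hk i (by omega)) (fun r hr => h r ⟨hr.1, hr.2.trans ht.2⟩)⟩

lemma FactorChain.exists_first_zero (hx : FactorChain α x) (hs : OneSignChange x j s)
    (hb : ∀ k ≤ 5, ∀ t, |x k t| ≤ C) {i : ℕ} (hi : i ≤ 4) (hαi : 0 < α i)
    (hαi' : 0 < α (i + 1)) {m : ℕ} (hm : m ≤ 5) (hpos : 0 < x m s) :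
    ∃ T, s < T ∧ (∀ t ∈ Set.Ioo s T, 0 < x 0 t) ∧ x 0 T = 0 := by
  have hmj : m ≤ j := by
    by_contra! h
    linarith [hs.2 m hm h]
  obtain ⟨δ, hδ, hr⟩ := hx.exists_pos_right (s := s) m 0 (by omega) (by simpa using hpos)
    (fun k hk => hs.1 k (by omega))
  have hc := hx.continuous (k := 0) (by omega)
  have hnot := hx.not_pos_forever hs hb hi hαi hαi'
  push Not at hnot
  obtain ⟨t₀, hst₀, ht₀⟩ := hnot
  set S : Set ℝ := {t | s + δ / 2 ≤ t ∧ x 0 t ≤ 0} with hS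
  have ht₀S : t₀ ∈ S := by
    refine ⟨?_, ht₀⟩
    by_contra! h
    linarith [hr t₀ ⟨hst₀, by linarith⟩]
  have hcl : IsClosed S :=
    (isClosed_le continuous_const continuous_id).inter (isClosed_le hc continuous_const)
  have hbd : BddBelow S := ⟨s + δ / 2, fun t ht => ht.1⟩
  have hT := hcl.csInf_mem ⟨t₀, ht₀S⟩ hbd
  have hsT : s < sInf S := by linarith [hT.1]
  have hp : ∀ t ∈ Set.Ioo s (sInf S), 0 < x 0 t := by
    intro t ht
    by_contra! h
    rcases lt_or_ge t (s + δ) with h1 | h1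
    · linarith [hr t ⟨ht.1, h1⟩]
    · linarith [csInf_le hbd (show t ∈ S from ⟨by linarith, h⟩), ht.2]
  refine ⟨sInf S, hsT, hp, le_antisymm hT.2 ?_⟩
  have := closure_minimal (fun t ht => (hp t ht).le : Set.Ioo s (sInf S) ⊆ {t | 0 ≤ x 0 t})
    (isClosed_le continuous_const hc)
  rw [closure_Ioo hsT.ne] at this
  exact this (Set.right_mem_Icc.2 hsT.le)

/-- All derived components are strictly positive at a zero of `x 0`. -/
def StrictStart (x : ℕ → ℝ → ℝ) (s : ℝ) : Prop :=
  x 0 s = 0 ∧ ∀ k, 1 ≤ k → k ≤ 5 → 0 < x k s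

lemma StrictStart.oneSignChange (h : StrictStart x s) : OneSignChange x 5 s := by
  refine ⟨fun k hk => ?_, fun k hk hk' => by omega⟩
  rcases Nat.eq_zero_or_pos k with rfl | hk1
  · exact h.1.ge
  · exact (h.2 k hk1 hk).le

lemma FactorChain.strictStart_neg (hx : FactorChain α x) (hs : OneSignChange x j s)
    (hsT : s < T) (h0 : ∀ t ∈ Set.Ioo s T, 0 < x 0 t) (hT : x 0 T = 0) :
    StrictStart (fun k t => -x k t) T := by
  have hI : ∀ t ∈ Set.Ioo s T, s < t ∧ Set.Ioo s t ⊆ Set.Ioo s T :=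
    fun t ht => ⟨ht.1, fun r hr => ⟨hr.1, hr.2.trans ht.2⟩⟩
  have hph := hx.phase hI h0 hs
  obtain ⟨t₀, ht₀, h₁⟩ : ∃ t₀ ∈ Set.Ioo s T, x 1 t₀ ≤ 0 := by
    by_contra! h
    have := pos_of_source_pos (hx.deriv 0 (by omega)) hsT (hs.1 0 (by omega)) h
    linarith
  have hk : ∀ k, k ≤ 5 → x (k + 1) t₀ ≤ 0 := by
    intro k
    induction k with
    | zero => exact fun _ => h₁
    | succ k ih =>
      intro hk
      exact (hph (5 - k) (k + 1) (by omega) (by omega)).2.2 hk t₀ ht₀ (ih (by omega))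
  refine ⟨by simp [hT], fun k hk1 hk5 => ?_⟩
  obtain ⟨k, rfl⟩ : ∃ l, k = l + 1 := ⟨k - 1, by omega⟩
  have := neg_of_source_neg (hx.deriv (k + 1) (by omega)) ht₀.2 (hk k (by omega))
    (fun r hr => (hph (4 - k) (k + 2) (by omega) (by omega)).1 t₀ ht₀ r
      ⟨ht₀.1.trans hr.1, hr.2⟩ hr.1 (hk (k + 1) (by omega)))
  linarith

/-- One half-oscillation of a chain on `[s, T]`: the component `x k` is positive before `τ k` and
negative after it. -/
structure HalfCycle (x : ℕ → ℝ → ℝ) (s T : ℝ) (τ : ℕ → ℝ) : Prop where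
  zero : τ 0 = T
  mem : ∀ k ≤ 5, s < τ k ∧ τ k ≤ T
  lt : ∀ k ≤ 4, τ (k + 1) < τ k
  pos : ∀ k ≤ 5, ∀ t ∈ Set.Ioo s (τ k), 0 < x k t
  nonneg : ∀ k ≤ 5, ∀ t ∈ Set.Icc s (τ k), 0 ≤ x k t
  nonpos : ∀ k ≤ 5, ∀ t ∈ Set.Icc (τ k) T, x k t ≤ 0

lemma FactorChain.exists_halfCycle (hx : FactorChain α x) (hs : StrictStart x s)
    (hsT : s < T) (h0 : ∀ t ∈ Set.Ioo s T, 0 < x 0 t) (hT : x 0 T = 0) :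
    ∃ τ, HalfCycle x s T τ := by
  have hI : ∀ t ∈ Set.Ioo s T, s < t ∧ Set.Ioo s t ⊆ Set.Ioo s T :=
    fun t ht => ⟨ht.1, fun r hr => ⟨hr.1, hr.2.trans ht.2⟩⟩
  have hph := hx.phase hI h0 hs.oneSignChange
  have hTneg := (hx.strictStart_neg hs.oneSignChange hsT h0 hT).2
  have hzero : ∀ k, 1 ≤ k → k ≤ 5 → ∃ t ∈ Set.Ioo s T, x k t = 0 := by
    intro k hk1 hk5
    have h1 : x k T < 0 := by have := hTneg k hk1 hk5; linarith
    have h2 := hs.2 k hk1 hk5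
    obtain ⟨t, ht, h⟩ := intermediate_value_Icc' hsT.le (hx.continuous hk5).continuousOn
      ⟨h1.le, h2.le⟩
    refine ⟨t, ⟨lt_of_le_of_ne ht.1 ?_, lt_of_le_of_ne ht.2 ?_⟩, h⟩
    · rintro rfl; linarith
    · rintro rfl; linarith
  choose! σ hσ hσ0 using hzero
  let τ : ℕ → ℝ := fun k => if k = 0 then T else σ k
  have hτ0 : τ 0 = T := by simp [τ]
  have hτ : ∀ k, 1 ≤ k → τ k = σ k := fun k hk => by simp [τ, show k ≠ 0 by omega]
  have hz : ∀ k ≤ 5, x k (τ k) = 0 := by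
    intro k hk
    rcases Nat.eq_zero_or_pos k with rfl | hk1
    · rw [hτ0, hT]
    · rw [hτ k hk1, hσ0 k hk1 hk]
  have hm : ∀ k ≤ 5, s < τ k ∧ τ k ≤ T := by
    intro k hk
    rcases Nat.eq_zero_or_pos k with rfl | hk1
    · rw [hτ0]; exact ⟨hsT, le_rfl⟩
    · rw [hτ k hk1]; exact ⟨(hσ k hk1 hk).1, (hσ k hk1 hk).2.le⟩
  have hmI : ∀ k, 1 ≤ k → k ≤ 5 → τ k ∈ Set.Ioo s T := fun k hk1 hk => by
    rw [hτ k hk1]; exact hσ k hk1 hk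
  have hpos : ∀ k ≤ 5, ∀ t ∈ Set.Ioo s (τ k), 0 < x k t := by
    intro k hk t ht
    rcases Nat.eq_zero_or_pos k with rfl | hk1
    · rw [hτ0] at ht; exact h0 t ht
    · by_contra! h
      have := (hph (6 - k) k (by omega) hk1).1 t ⟨ht.1, ht.2.trans_le (hm k hk).2⟩ (τ k)
        (hmI k hk1 hk) ht.2 h
      linarith [hz k hk]
  have hneg : ∀ k ≤ 5, ∀ t ∈ Set.Ioo (τ k) T, x k t < 0 := by
    intro k hk t ht
    rcases Nat.eq_zero_or_pos k with rfl | hk1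
    · rw [hτ0] at ht; linarith [ht.1, ht.2]
    · exact (hph (6 - k) k (by omega) hk1).1 (τ k) (hmI k hk1 hk) t
        ⟨(hm k hk).1.trans ht.1, ht.2⟩ ht.1 (hz k hk).le
  have hnn : ∀ k ≤ 5, 0 ≤ x k s := hs.oneSignChange.1
  refine ⟨τ, hτ0, hm, fun k hk => ?_, hpos, fun k hk t ht => ?_, fun k hk t ht => ?_⟩
  · by_contra! h
    have := pos_of_source_pos (hx.deriv k (by omega)) (hm k (by omega)).1 (hnn k (by omega))
      (fun r hr => hpos (k + 1) (by omega) r ⟨hr.1, hr.2.trans_le h⟩)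
    linarith [hz k (by omega)]
  · rcases ht.1.eq_or_lt with rfl | h1
    · exact hnn k hk
    · rcases ht.2.eq_or_lt with rfl | h2
      · exact (hz k hk).ge
      · exact (hpos k hk t ⟨h1, h2⟩).le
  · rcases ht.1.eq_or_lt with rfl | h1
    · exact (hz k hk).le
    · rcases ht.2.eq_or_lt with rfl | h2
      · rcases Nat.eq_zero_or_pos k with rfl | hk1
        · exact hT.le
        · have := hTneg k hk1 hk; linarith
      · exact (hneg k hk t ⟨h1, h2⟩).le

/-- The amplitude compared between consecutive half-oscillations. -/
def amplitude (o : ℕ) (κ : ℝ) (x : ℕ → ℝ → ℝ) (τ : ℕ → ℝ) : ℝ :=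
  x o (τ (o + 2)) ^ 2 * x (o + 1) (τ (o + 2)) *
    (x (o + 2) (τ (o + 3)) /
      ((τ (o + 2) - τ (o + 3)) * exp (κ * (τ (o + 2) - τ (o + 3))))) ^ 2

lemma HalfCycle.amplitude_pos {τ : ℕ → ℝ} (h : HalfCycle x s T τ) {o : ℕ} (ho : o ≤ 2) (κ : ℝ) :
    0 < amplitude o κ x τ := by
  have h0 := h.lt o (by omega)
  have h1 := h.lt (o + 1) (by omega)
  have h2 := h.lt (o + 2) (by omega)
  have hm := (h.mem (o + 3) (by omega)).1
  have e1 : 0 < x o (τ (o + 2)) := h.pos o (by omega) _ ⟨by linarith, by linarith⟩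
  have e2 : 0 < x (o + 1) (τ (o + 2)) := h.pos (o + 1) (by omega) _ ⟨by linarith, by linarith⟩
  have e3 : 0 < x (o + 2) (τ (o + 3)) := h.pos (o + 2) (by omega) _ ⟨by linarith, by linarith⟩
  have e4 : 0 < τ (o + 2) - τ (o + 3) := by linarith
  unfold amplitude
  positivity

lemma FactorChain.amplitude_le (hx : FactorChain α x) {o : ℕ} {κ : ℝ} (ho : o ≤ 2)
    (hα₁ : κ ≤ α o) (hα₂ : |κ| ≤ α (o + 1)) (hα₃ : |κ| ≤ α (o + 2)) (hα₄ : -κ ≤ α (o + 3))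
    {T' : ℝ} {τ τ' : ℕ → ℝ} (h : HalfCycle x s T τ)
    (h' : HalfCycle (fun k t => -x k t) T T' τ') (hb : ∀ k ≤ 5, ∀ t, |x k t| ≤ C) :
    4 * amplitude o κ x τ ≤ amplitude o κ (fun k t => -x k t) τ' ∧
      amplitude o κ x τ ≤ C ^ 2 * C * C ^ 2 := by
  have h0 := h.lt o (by omega)
  have h1 := h.lt (o + 1) (by omega)
  have h2 := h.lt (o + 2) (by omega)
  have h0' := h'.lt o (by omega)
  have h1' := h'.lt (o + 1) (by omega)
  have h2' := h'.lt (o + 2) (by omega)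
  have hmT := (h.mem o (by omega)).2
  have hm := (h.mem (o + 3) (by omega)).1
  have hm' := (h'.mem (o + 3) (by omega)).1
  have hneg : ∀ k ≤ 5, ∀ t ∈ Set.Icc (τ k) (τ' k), x k t ≤ 0 := by
    intro k hk t ht
    rcases le_total t T with htT | htT
    · exact h.nonpos k hk t ⟨ht.1, htT⟩
    · have := h'.nonneg k hk t ⟨htT, ht.2⟩
      linarith
  have hnn : ∀ k ≤ 5, ∀ t ∈ Set.Icc (τ (o + 3)) (τ k), 0 ≤ x k t := fun k hk t ht =>
    h.nonneg k hk t ⟨by linarith [ht.1], ht.2⟩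
  have hlast : ∀ t ∈ Set.Icc (τ (o + 3)) (τ o), x (o + 4) t ≤ 0 := by
    intro t ht
    rcases (show o ≤ 1 ∨ o = 2 by omega) with ho1 | rfl
    · have := h.lt (o + 3) (by omega)
      exact h.nonpos (o + 4) (by omega) t ⟨by linarith [ht.1], by linarith [ht.2]⟩
    · refine (hx.neg t (h.pos 0 (by omega) t ⟨by linarith [ht.1], ?_⟩)).le
      linarith [ht.2, h.lt 0 (by omega), h.lt 1 (by omega)]
  obtain ⟨g₁, g₂⟩ := amplitude_growth (hx.deriv o (by omega)) (hx.deriv (o + 1) (by omega))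
    (hx.deriv (o + 2) (by omega)) (hx.deriv (o + 3) (by omega)) hα₁ hα₂ hα₃ hα₄ h2 h1 h0
    (show τ o ≤ τ' (o + 3) by linarith) h2'
    (fun t ht => hnn o (by omega) t ⟨by linarith [ht.1], ht.2⟩)
    (fun t ht => hneg o (by omega) t ⟨ht.1, by linarith [ht.2]⟩)
    (fun t ht => hnn (o + 1) (by omega) t ⟨by linarith [ht.1], ht.2⟩)
    (fun t ht => hneg (o + 1) (by omega) t ⟨ht.1, by linarith [ht.2]⟩)
    (fun t ht => hnn (o + 2) (by omega) t ht)
    (fun t ht => hneg (o + 2) (by omega) t ht)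
    (fun t ht => hneg (o + 3) (by omega) t ht) hlast
  refine ⟨g₁, ?_⟩
  have e1 := (le_abs_self _).trans (hb o (by omega) (τ (o + 2)))
  have e2 := (le_abs_self _).trans (hb (o + 1) (by omega) (τ (o + 2)))
  have e3 := g₂.trans ((neg_le_abs _).trans (hb (o + 3) (by omega) (τ (o + 2))))
  have n1 := hnn o (by omega) (τ (o + 2)) ⟨by linarith, by linarith⟩
  have n2 := hnn (o + 1) (by omega) (τ (o + 2)) ⟨by linarith, by linarith⟩
  have n3 : 0 ≤ x (o + 2) (τ (o + 3)) /
      ((τ (o + 2) - τ (o + 3)) * exp (κ * (τ (o + 2) - τ (o + 3)))) :=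
    div_nonneg (hnn (o + 2) (by omega) _ ⟨le_rfl, h2.le⟩)
      (mul_nonneg (by linarith) (exp_pos _).le)
  have hC : 0 ≤ C := n1.trans e1
  unfold amplitude
  gcongr

/-- A chain whose rates allow both escape and amplitude growth has no bounded solution passing
through a sign pattern with at most one change. -/
theorem FactorChain.no_oneSignChange (hx : FactorChain α x)
    (hb : ∀ k ≤ 5, ∀ t, |x k t| ≤ C) {i : ℕ} (hi : i ≤ 4) (hαi : 0 < α i)
    (hαi' : 0 < α (i + 1)) {o : ℕ} {κ : ℝ} (ho : o ≤ 2)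
    (hα₁ : κ ≤ α o) (hα₂ : |κ| ≤ α (o + 1)) (hα₃ : |κ| ≤ α (o + 2)) (hα₄ : -κ ≤ α (o + 3))
    (hs : OneSignChange x j s) {m : ℕ} (hm : m ≤ 5) (hpos : 0 < x m s) : False := by
  have start : ∀ {y : ℕ → ℝ → ℝ} {r : ℝ} {l q : ℕ}, FactorChain α y →
      (∀ k ≤ 5, ∀ t, |y k t| ≤ C) → OneSignChange y l r → q ≤ 5 → 0 < y q r →
      ∃ T, r < T ∧ (∀ t ∈ Set.Ioo r T, 0 < y 0 t) ∧ y 0 T = 0 ∧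
        StrictStart (fun k t => -y k t) T := by
    intro y r l q hy hby hr hq hyq
    obtain ⟨T, hT, hT0, hTz⟩ := hy.exists_first_zero hr hby hi hαi hαi' hq hyq
    exact ⟨T, hT, hT0, hTz, hy.strictStart_neg hr hT hT0 hTz⟩
  have cycle : ∀ {y : ℕ → ℝ → ℝ} {r : ℝ}, FactorChain α y →
      (∀ k ≤ 5, ∀ t, |y k t| ≤ C) → StrictStart y r →
      ∃ T τ, HalfCycle y r T τ ∧ StrictStart (fun k t => -y k t) T := by
    intro y r hy hby hr
    obtain ⟨T, hT, hT0, hTz, hTs⟩ := start hy hby hr.oneSignChange le_rfl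
      (hr.2 5 (by omega) le_rfl)
    obtain ⟨τ, hτ⟩ := hy.exists_halfCycle hr hT hT0 hTz
    exact ⟨T, τ, hτ, hTs⟩
  have hneg : ∀ {y : ℕ → ℝ → ℝ}, (∀ k ≤ 5, ∀ t, |y k t| ≤ C) →
      ∀ k ≤ 5, ∀ t, |(fun k t => -y k t) k t| ≤ C := by
    intro y hy k hk t
    simpa using hy k hk t
  have grow : ∀ N : ℕ, ∀ (y : ℕ → ℝ → ℝ) (r T : ℝ) (τ : ℕ → ℝ), FactorChain α y →
      (∀ k ≤ 5, ∀ t, |y k t| ≤ C) → HalfCycle y r T τ → StrictStart (fun k t => -y k t) T →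
      4 ^ N * amplitude o κ y τ ≤ C ^ 2 * C * C ^ 2 := by
    intro N
    induction N with
    | zero =>
      intro y r T τ hy hby hτ hT
      obtain ⟨T', τ', hτ', -⟩ := cycle hy.neg_chain (hneg hby) hT
      simpa using (hy.amplitude_le ho hα₁ hα₂ hα₃ hα₄ hτ hτ' hby).2
    | succ N ih =>
      intro y r T τ hy hby hτ hT
      obtain ⟨T', τ', hτ', hT'⟩ := cycle hy.neg_chain (hneg hby) hT
      have h₁ := (hy.amplitude_le ho hα₁ hα₂ hα₃ hα₄ hτ hτ' hby).1
      have h₂ := ih _ T T' τ' hy.neg_chain (hneg hby) hτ' hT'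
      calc (4 : ℝ) ^ (N + 1) * amplitude o κ y τ = 4 ^ N * (4 * amplitude o κ y τ) := by ring
        _ ≤ 4 ^ N * amplitude o κ (fun k t => -y k t) τ' := by gcongr
        _ ≤ _ := h₂
  obtain ⟨T, -, -, -, hT⟩ := start hx hb hs hm hpos
  obtain ⟨T', τ, hτ, hT'⟩ := cycle hx.neg_chain (hneg hb) hT
  have hp := hτ.amplitude_pos ho κ
  obtain ⟨N, hN⟩ := pow_unbounded_of_one_lt
    (C ^ 2 * C * C ^ 2 / amplitude o κ (fun k t => -x k t) τ) (show (1 : ℝ) < 4 by norm_num)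
  rw [div_lt_iff₀ hp] at hN
  linarith [grow N _ T T' τ hx.neg_chain (hneg hb) hτ hT']

end Phase

section Propagation

variable {β G : ℝ} {u g : ℝ → ℝ}

/-- `u` is bounded along points that are uniformly dense at every scale. -/
def BoundedOnNet (u : ℝ → ℝ) : Prop := ∀ h > 0, ∃ K, ∀ t, ∃ s ∈ Set.Icc t (t + h), |u s| ≤ K

lemma BoundedOnNet.source (hu : BoundedOnNet u) (h : ∀ t, HasDerivAt u (β * u t + g t) t) :
    BoundedOnNet g := by
  intro l hl
  obtain ⟨K, hK⟩ := hu (l / 3) (by positivity)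
  set E := exp (|β| * l) with hE
  have hexp : ∀ r, |r| ≤ l → exp (β * r) ≤ E := fun r hr => exp_le_exp.2 <| by
    calc β * r ≤ |β * r| := le_abs_self _
      _ = |β| * |r| := abs_mul _ _
      _ ≤ |β| * l := by gcongr
  refine ⟨E * ((K + E * K) / (l / 3)), fun t => ?_⟩
  obtain ⟨p, hp, hup⟩ := hK t
  obtain ⟨r, hr, hur⟩ := hK (t + 2 * l / 3)
  have hpr : l / 3 ≤ r - p := by linarith [hp.2, hr.1]
  have hrl : r - p ≤ l := by linarith [hp.1, hr.2]
  have hd : ∀ y, HasDerivAt (fun y => exp (-β * (y - p)) * u y)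
      (exp (-β * (y - p)) * g y) y := by
    intro y
    have h1 : HasDerivAt (fun y : ℝ => exp (-β * (y - p))) (exp (-β * (y - p)) * (-β * 1)) y :=
      (((hasDerivAt_id y).sub_const p).const_mul (-β)).exp
    exact (h1.mul (h y)).congr_deriv (by ring)
  obtain ⟨ξ, hξ, hs⟩ := exists_hasDerivAt_eq_slope _ _ (show p < r by linarith)
    (fun y _ => (hd y).continuousAt.continuousWithinAt) (fun y _ => hd y)
  refine ⟨ξ, ⟨by linarith [hp.1, hξ.1], by linarith [hr.2, hξ.2]⟩, ?_⟩
  have hg : g ξ = exp (β * (ξ - p)) * ((exp (-β * (r - p)) * u r - u p) / (r - p)) := by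
    have h1 : exp (β * (ξ - p)) * exp (-β * (ξ - p)) = 1 := by
      rw [← exp_add, ← exp_zero]; ring_nf
    have h2 : exp (-β * (p - p)) = 1 := by simp
    rw [h2, one_mul] at hs
    rw [← hs, ← mul_assoc, h1, one_mul]
  have hK0 : 0 ≤ K := (abs_nonneg _).trans hup
  have e1 : |exp (-β * (r - p)) * u r - u p| ≤ K + E * K := by
    have : exp (-β * (r - p)) ≤ E := by
      have := hexp (-(r - p)) (by rw [abs_neg, abs_of_nonneg (by linarith)]; exact hrl)
      rwa [show -β * (r - p) = β * -(r - p) by ring]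
    calc |exp (-β * (r - p)) * u r - u p| ≤ |exp (-β * (r - p)) * u r| + |u p| := abs_sub _ _
      _ = exp (-β * (r - p)) * |u r| + |u p| := by rw [abs_mul, abs_of_pos (exp_pos _)]
      _ ≤ E * K + K := by gcongr
      _ = _ := by ring
  rw [hg, abs_mul, abs_of_pos (exp_pos _), abs_div, abs_of_pos (show 0 < r - p by linarith)]
  have e2 := hexp (ξ - p) (by
    rw [abs_of_nonneg (by linarith [hξ.1])]
    linarith [hξ.2])
  have e3 : 0 ≤ |exp (-β * (r - p)) * u r - u p| / (r - p) :=
    div_nonneg (abs_nonneg _) (by linarith)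
  gcongr

lemma BoundedOnNet.bounded (hu : BoundedOnNet u) (h : ∀ t, HasDerivAt u (β * u t + g t) t)
    (hg : ∀ t, |g t| ≤ G) : ∃ C, ∀ t, |u t| ≤ C := by
  obtain ⟨K, hK⟩ := hu 1 one_pos
  have hG : 0 ≤ G := (abs_nonneg _).trans (hg 0)
  refine ⟨gronwallBound K |β| G 1, fun t => ?_⟩
  obtain ⟨s, hs, hus⟩ := hK (t - 1)
  have hst : s ≤ t := by linarith [hs.2]
  have := norm_le_gronwallBound_of_norm_deriv_right_le (f := u)
    (f' := fun t => β * u t + g t) (a := s) (b := t) (δ := K) (K := |β|) (ε := G)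
    (fun y _ => (h y).continuousAt.continuousWithinAt) (fun y _ => (h y).hasDerivWithinAt)
    hus (fun y _ => by
      calc ‖β * u y + g y‖ ≤ ‖β * u y‖ + ‖g y‖ := norm_add_le _ _
        _ = |β| * ‖u y‖ + |g y| := by rw [norm_mul]; rfl
        _ ≤ |β| * ‖u y‖ + G := by gcongr; exact hg y) t ⟨hst, le_rfl⟩
  exact this.trans (gronwallBound_mono ((abs_nonneg _).trans hus) hG (abs_nonneg _)
    (by linarith [hs.1]))

end Propagation

section Chain

variable {α : ℕ → ℝ} {x : ℕ → ℝ → ℝ} {s C M G L A : ℝ} {j : ℕ}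

lemma FactorChain.bounded (hx : FactorChain α x) (h0 : ∀ t, |x 0 t| ≤ M)
    (h6 : ∀ t, |x 6 t| ≤ G) : ∃ C, ∀ k ≤ 5, ∀ t, |x k t| ≤ C := by
  have hnet : ∀ k ≤ 5, BoundedOnNet (x k) := by
    intro k
    induction k with
    | zero => exact fun _ l hl => ⟨M, fun t => ⟨t, ⟨le_rfl, by linarith⟩, h0 t⟩⟩
    | succ k ih => exact fun hk => (ih (by omega)).source (hx.deriv k (by omega))
  have hbd : ∀ i, ∀ k, k + i = 6 → ∃ C, ∀ t, |x k t| ≤ C := by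
    intro i
    induction i with
    | zero => exact fun k hk => ⟨G, by obtain rfl : k = 6 := hk; exact h6⟩
    | succ i ih =>
      intro k hk
      obtain ⟨G', hG'⟩ := ih (k + 1) (by omega)
      exact (hnet k (by omega)).bounded (hx.deriv k (by omega)) hG'
  choose! B hB using fun k (hk : k ≤ 5) => hbd (6 - k) k (by omega)
  have hB0 : ∀ k ≤ 5, 0 ≤ B k := fun k hk => (abs_nonneg _).trans (hB k hk 0)
  refine ⟨∑ k ∈ Finset.range 6, B k, fun k hk t => (hB k hk t).trans ?_⟩
  exact Finset.single_le_sum (fun i hi => hB0 i (by have := Finset.mem_range.1 hi; omega))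
    (Finset.mem_range.2 (by omega))

lemma FactorChain.eq_zero_of_nonneg (hx : FactorChain α x) (hα : ∀ k < 6, |α k| ≤ A)
    (hL : ∀ t, |x 6 t| ≤ L * |x 0 t|) (h0 : ∀ k ≤ 5, x k 0 = 0) {t : ℝ} (ht : 0 ≤ t) :
    x 0 t = 0 := by
  have hE : ∀ t, HasDerivAt (fun t => ∑ k ∈ Finset.range 6, x k t ^ 2)
      (0 * (∑ k ∈ Finset.range 6, x k t ^ 2) +
        ∑ k ∈ Finset.range 6, 2 * x k t * (α k * x k t + x (k + 1) t)) t := by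
    intro t
    rw [zero_mul, zero_add]
    refine HasDerivAt.fun_sum fun k hk => ?_
    exact ((hx.deriv k (Finset.mem_range.1 hk) t).pow 2).congr_deriv (by simp)
  have hbound : ∀ t, ∑ k ∈ Finset.range 6, 2 * x k t * (α k * x k t + x (k + 1) t) ≤
      (2 * A + 2 + L ^ 2) * ∑ k ∈ Finset.range 6, x k t ^ 2 := by
    intro t
    have h1 : ∀ k ∈ Finset.range 6, 2 * x k t * (α k * x k t + x (k + 1) t) ≤
        (2 * A + 1) * x k t ^ 2 + x (k + 1) t ^ 2 := by
      intro k hk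
      have := (le_abs_self _).trans (hα k (Finset.mem_range.1 hk))
      nlinarith [sq_nonneg (x k t - x (k + 1) t), sq_nonneg (x k t)]
    have h2 : x 6 t ^ 2 ≤ L ^ 2 * x 0 t ^ 2 := by
      have := pow_le_pow_left₀ (abs_nonneg _) (hL t) 2
      rwa [mul_pow, sq_abs, sq_abs] at this
    refine (Finset.sum_le_sum h1).trans ?_
    simp only [Finset.sum_range_succ, Finset.sum_range_zero, zero_add]
    norm_num
    have e := mul_nonneg (sq_nonneg L) (sq_nonneg (x 1 t))
    have e2 := mul_nonneg (sq_nonneg L) (sq_nonneg (x 2 t))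
    have e3 := mul_nonneg (sq_nonneg L) (sq_nonneg (x 3 t))
    have e4 := mul_nonneg (sq_nonneg L) (sq_nonneg (x 4 t))
    have e5 := mul_nonneg (sq_nonneg L) (sq_nonneg (x 5 t))
    have e0 := sq_nonneg (x 0 t)
    linarith
  have key := exp_mul_le_exp_mul_of_nonpos (κ := 2 * A + 2 + L ^ 2) hE ht
    (fun y _ => by have := hbound y; linarith)
  have hz : ∑ k ∈ Finset.range 6, x k 0 ^ 2 = 0 := Finset.sum_eq_zero fun k hk => by
    rw [h0 k (by have := Finset.mem_range.1 hk; omega)]; ring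
  rw [hz, mul_zero] at key
  have h3 : ∑ k ∈ Finset.range 6, x k t ^ 2 ≤ 0 :=
    nonpos_of_mul_nonpos_right key (exp_pos _)
  have h4 : x 0 t ^ 2 ≤ ∑ k ∈ Finset.range 6, x k t ^ 2 :=
    Finset.single_le_sum (f := fun k => x k t ^ 2) (fun i _ => sq_nonneg _)
      (Finset.mem_range.2 (by omega))
  exact pow_eq_zero_iff (two_ne_zero) |>.1 (le_antisymm (h4.trans h3) (sq_nonneg _))

lemma FactorChain.eq_zero_of_eq_zero_at (hx : FactorChain α x) (hα : ∀ k < 6, |α k| ≤ A)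
    (hL : ∀ t, |x 6 t| ≤ L * |x 0 t|) (h0 : ∀ k ≤ 5, x k 0 = 0) (t : ℝ) : x 0 t = 0 := by
  rcases le_total 0 t with ht | ht
  · exact hx.eq_zero_of_nonneg hα hL h0 ht
  · have := hx.reverse.eq_zero_of_nonneg (A := A) (L := L) (by simpa using hα)
      (fun r => by norm_num; exact hL (-r)) (fun k hk => by simp [h0 k hk])
      (show 0 ≤ -t by linarith)
    simpa using this

/-- A bounded chain with at most one sign change in its initial data, up to a global sign,
starts from zero. -/
lemma FactorChain.eq_zero_of_oneSignChange (hx : FactorChain α x)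
    (hb : ∀ k ≤ 5, ∀ t, |x k t| ≤ C) {i : ℕ} (hi : i ≤ 4) (hαi : 0 < α i)
    (hαi' : 0 < α (i + 1)) {o : ℕ} {κ : ℝ} (ho : o ≤ 2)
    (hα₁ : κ ≤ α o) (hα₂ : |κ| ≤ α (o + 1)) (hα₃ : |κ| ≤ α (o + 2)) (hα₄ : -κ ≤ α (o + 3))
    (hs : OneSignChange x j s ∨ OneSignChange (fun k t => -x k t) j s) :
    ∀ k ≤ 5, x k s = 0 := by
  have main : ∀ y : ℕ → ℝ → ℝ, FactorChain α y → (∀ k ≤ 5, ∀ t, |y k t| ≤ C) →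
      OneSignChange y j s → ∀ k ≤ 5, y k s = 0 := by
    intro y hy hby hys
    have hle : ∀ k ≤ 5, y k s ≤ 0 := by
      intro k hk
      by_contra! hpos
      exact hy.no_oneSignChange hby hi hαi hαi' ho hα₁ hα₂ hα₃ hα₄ hys hk hpos
    have hys' : OneSignChange (fun k t => -y k t) 5 s :=
      ⟨fun k hk => by simpa using hle k hk, fun k hk hk' => by omega⟩
    intro k hk
    refine le_antisymm (hle k hk) ?_
    by_contra! hneg
    exact hy.neg_chain.no_oneSignChange (C := C) (by simpa using hby) hi hαi hαi' ho
      hα₁ hα₂ hα₃ hα₄ hys' hk (by linarith)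
  rcases hs with hs | hs
  · exact main x hx hb hs
  · intro k hk
    have := main _ hx.neg_chain (by simpa using hb) hs k hk
    linarith

/-- The signs of `p, q, r, v` change at most once, from plus to minus. -/
def PlusMinus (p q r v : ℝ) : Prop :=
  (0 ≤ p ∧ 0 ≤ q ∧ 0 ≤ r ∧ 0 ≤ v) ∨ (0 ≤ p ∧ 0 ≤ q ∧ 0 ≤ r ∧ v ≤ 0) ∨
    (0 ≤ p ∧ 0 ≤ q ∧ r ≤ 0 ∧ v ≤ 0) ∨ (0 ≤ p ∧ q ≤ 0 ∧ r ≤ 0 ∧ v ≤ 0)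

lemma plusMinus_cases (p q r v : ℝ) : PlusMinus p q r v ∨ PlusMinus (-p) (-q) (-r) (-v) ∨
    PlusMinus p (-q) r (-v) ∨ PlusMinus (-p) q (-r) v := by
  simp only [PlusMinus, Left.nonneg_neg_iff, Left.neg_nonpos_iff]
  rcases le_total 0 p with a | a <;> rcases le_total 0 q with b | b <;>
    rcases le_total 0 r with c | c <;> rcases le_total 0 v with d | d <;>
    simp [a, b, c, d]

lemma PlusMinus.oneSignChange (h0 : x 0 s = 0) (h1 : x 1 s = 0)
    (h : PlusMinus (x 2 s) (x 3 s) (x 4 s) (x 5 s)) : ∃ j, OneSignChange x j s := by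
  rcases h with ⟨p, q, r, v⟩ | ⟨p, q, r, v⟩ | ⟨p, q, r, v⟩ | ⟨p, q, r, v⟩
  · refine ⟨5, fun k hk => ?_, fun k hk hk' => by omega⟩
    interval_cases k <;> linarith
  · refine ⟨4, fun k hk => ?_, fun k hk hk' => ?_⟩ <;> interval_cases k <;> linarith
  · refine ⟨3, fun k hk => ?_, fun k hk hk' => ?_⟩ <;> interval_cases k <;> linarith
  · refine ⟨2, fun k hk => ?_, fun k hk hk' => ?_⟩ <;> interval_cases k <;> linarith

/-- If the first two entries vanish, the data or its time reversal has at most one sign change. -/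
lemma exists_oneSignChange (h0 : x 0 0 = 0) (h1 : x 1 0 = 0) :
    ∃ j, (OneSignChange x j 0 ∨ OneSignChange (fun k t => -x k t) j 0) ∨
      OneSignChange (fun k t => (-1) ^ k * x k (-t)) j 0 ∨
      OneSignChange (fun k t => -((-1) ^ k * x k (-t))) j 0 := by
  rcases plusMinus_cases (x 2 0) (x 3 0) (x 4 0) (x 5 0) with h | h | h | h
  · obtain ⟨j, hj⟩ := h.oneSignChange h0 h1
    exact ⟨j, .inl (.inl hj)⟩
  · obtain ⟨j, hj⟩ := PlusMinus.oneSignChange (x := fun k t => -x k t) (by simp [h0])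
      (by simp [h1]) h
    exact ⟨j, .inl (.inr hj)⟩
  · obtain ⟨j, hj⟩ := PlusMinus.oneSignChange (x := fun k t => (-1) ^ k * x k (-t)) (s := 0)
      (by simp [h0]) (by simp [h1]) (by norm_num; exact h)
    exact ⟨j, .inr (.inl hj)⟩
  · obtain ⟨j, hj⟩ := PlusMinus.oneSignChange (x := fun k t => -((-1) ^ k * x k (-t))) (s := 0)
      (by simp [h0]) (by simp [h1]) (by norm_num; exact h)
    exact ⟨j, .inr (.inr hj)⟩

/-- The rates `c, b, a, -a, -b, -c`. -/
def rates (a b c : ℝ) (k : ℕ) : ℝ := [c, b, a, -a, -b, -c].getD k 0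

/-- A bounded chain with symmetric rates is determined by its first two components at `0`. -/
theorem FactorChain.eq_zero {a b c : ℝ} (ha : 0 < a) (hab : a ≤ b) (hbc : b ≤ c)
    (hx : FactorChain (rates a b c) x) (hM : ∀ t, |x 0 t| ≤ M)
    (hL : ∀ t, |x 6 t| ≤ L * |x 0 t|) (h0 : x 0 0 = 0) (h1 : x 1 0 = 0) (t : ℝ) :
    x 0 t = 0 := by
  obtain ⟨C, hC⟩ := hx.bounded (G := |L| * M) hM (fun t => (hL t).trans (by
    calc L * |x 0 t| ≤ |L| * |x 0 t| := by gcongr; exact le_abs_self L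
      _ ≤ |L| * M := by gcongr; exact hM t))
  have hα : ∀ k < 6, |rates a b c k| ≤ c := by
    intro k hk
    interval_cases k <;> simp [rates, abs_le] <;> grind
  refine hx.eq_zero_of_eq_zero_at hα hL ?_ t
  have haa := abs_of_pos ha
  obtain ⟨j, h | h⟩ := exists_oneSignChange h0 h1
  · refine hx.eq_zero_of_oneSignChange hC (i := 0) (o := 0) (κ := a) (by omega) ?_ ?_ (by omega)
      ?_ ?_ ?_ ?_ h <;> simp [rates, haa] <;> linarith
  · have hC' : ∀ k ≤ 5, ∀ t, |(fun k t => (-1) ^ k * x k (-t)) k t| ≤ C := by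
      intro k hk t
      simpa [abs_mul] using hC k hk (-t)
    have := hx.reverse.eq_zero_of_oneSignChange hC' (i := 3) (o := 2) (κ := -a) (by omega)
      (by simp [rates]; linarith) (by simp [rates]; linarith) (by omega)
      (by simp [rates]) (by simp [rates, haa])
      (by simp [rates, haa]; linarith) (by simp [rates]; linarith) h
    intro k hk
    have := this k hk
    simpa using this

end Chain

section Nonlinearity

variable {p M r s : ℝ}

lemma abs_rpow_mul_self_strictMono (hp : 0 < p) : StrictMono fun r : ℝ => |r| ^ p * r := by
  have pos : ∀ s r : ℝ, 0 ≤ s → s < r → |s| ^ p * s < |r| ^ p * r := by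
    intro s r hs hsr
    have hr := hs.trans_lt hsr
    rw [abs_of_nonneg hs, abs_of_pos hr]
    have h1 := rpow_lt_rpow hs hsr hp
    nlinarith [rpow_pos_of_pos hr p]
  intro s r hsr
  show |s| ^ p * s < |r| ^ p * r
  rcases le_or_gt 0 s with hs | hs
  · exact pos s r hs hsr
  rcases le_or_gt 0 r with hr | hr
  · have h1 : |s| ^ p * s < 0 := mul_neg_of_pos_of_neg (rpow_pos_of_pos (abs_pos.2 hs.ne) p) hs
    have h2 : 0 ≤ |r| ^ p * r := by positivity
    linarith
  · have := pos (-r) (-s) (by linarith) (by linarith)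
    rw [abs_neg, abs_neg] at this
    linarith

lemma abs_rpow_mul_self_sub_le (hp : 0 < p) (hr : |r| ≤ M) (hs : |s| ≤ M) (hsr : s ≤ r) :
    |r| ^ p * r - |s| ^ p * s ≤ (p + 1) * M ^ p * (r - s) := by
  have hM : 0 ≤ M := (abs_nonneg _).trans hr
  have pos : ∀ s r : ℝ, |r| ≤ M → 0 ≤ s → s ≤ r →
      |r| ^ p * r - |s| ^ p * s ≤ (p + 1) * M ^ p * (r - s) := by
    intro s r hr hs hsr
    have hr0 := hs.trans hsr
    rw [abs_of_nonneg hr0] at hr ⊢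
    rw [abs_of_nonneg hs, ← rpow_add_one' hr0 (by linarith), ← rpow_add_one' hs (by linarith)]
    have hd : ∀ y : ℝ, HasDerivAt (fun y : ℝ => y ^ (p + 1)) ((p + 1) * y ^ p) y := fun y => by
      simpa using hasDerivAt_rpow_const (x := y) (p := p + 1) (.inr (by linarith))
    refine (convex_Icc s r).image_sub_le_mul_sub_of_deriv_le
      (fun y _ => (hd y).continuousAt.continuousWithinAt)
      (fun y _ => (hd y).differentiableAt.differentiableWithinAt) (fun y hy => ?_)
      s (Set.left_mem_Icc.2 hsr) r (Set.right_mem_Icc.2 hsr) hsr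
    rw [interior_Icc] at hy
    rw [(hd y).deriv]
    have : y ^ p ≤ M ^ p := rpow_le_rpow (by linarith [hy.1]) (by linarith [hy.2]) hp.le
    gcongr
  rcases le_or_gt 0 s with hs0 | hs0
  · exact pos s r hr hs0 hsr
  rcases le_or_gt 0 r with hr0 | hr0
  · have h1 : |r| ^ p ≤ M ^ p := rpow_le_rpow (abs_nonneg _) hr hp.le
    have h2 : |s| ^ p ≤ M ^ p := rpow_le_rpow (abs_nonneg _) hs hp.le
    have h3 := mul_le_mul_of_nonneg_right h1 hr0
    have h4 := mul_le_mul_of_nonneg_right h2 (show 0 ≤ -s by linarith)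
    have h5 : 0 ≤ p * (M ^ p * (r - s)) :=
      mul_nonneg hp.le (mul_nonneg (rpow_nonneg hM p) (by linarith))
    linarith
  · have := pos (-r) (-s) (by rwa [abs_neg]) (by linarith) (by linarith)
    rw [abs_neg, abs_neg] at this
    linarith

lemma abs_abs_rpow_mul_self_sub_le (hp : 0 < p) (hr : |r| ≤ M) (hs : |s| ≤ M) :
    |(|r| ^ p * r - |s| ^ p * s)| ≤ (p + 1) * M ^ p * |r - s| := by
  have hmono := (abs_rpow_mul_self_strictMono hp).monotone
  rcases le_total s r with h | h
  · rw [abs_of_nonneg (sub_nonneg.2 (hmono h)), abs_of_nonneg (sub_nonneg.2 h)]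
    exact abs_rpow_mul_self_sub_le hp hr hs h
  · rw [abs_sub_comm, abs_sub_comm r,
      abs_of_nonneg (sub_nonneg.2 (hmono h)), abs_of_nonneg (sub_nonneg.2 h)]
    exact abs_rpow_mul_self_sub_le hp hs hr h

end Nonlinearity

/-- Successive application of the operators `d/dt - α k` to a sequence of derivatives. -/
def factored (α : ℕ → ℝ) (D : ℕ → ℝ → ℝ) : ℕ → ℕ → ℝ → ℝ
  | 0, j => D j
  | k + 1, j => fun t => factored α D k (j + 1) t - α k * factored α D k j t

lemma hasDerivAt_factored {α : ℕ → ℝ} {D : ℕ → ℝ → ℝ} {N : ℕ}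
    (hD : ∀ j < N, ∀ t, HasDerivAt (D j) (D (j + 1) t) t) (k : ℕ) :
    ∀ j, k + j < N → ∀ t, HasDerivAt (factored α D k j) (factored α D k (j + 1) t) t := by
  induction k with
  | zero => exact fun j hj t => hD j (by omega) t
  | succ k ih => exact fun j hj t =>
      (ih (j + 1) (by omega) t).sub ((ih j (by omega) t).const_mul (α k))

lemma factored_rates_six (a b c : ℝ) (D : ℕ → ℝ → ℝ) (t : ℝ) :
    factored (rates a b c) D 6 0 t = D 6 t - (a ^ 2 + b ^ 2 + c ^ 2) * D 4 t +
      (a ^ 2 * b ^ 2 + b ^ 2 * c ^ 2 + c ^ 2 * a ^ 2) * D 2 t - a ^ 2 * b ^ 2 * c ^ 2 * D 0 t := by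
  simp [factored, rates]
  ring

lemma cN_pos {n : ℕ} (hn : 7 ≤ n) : 0 < cN n := by
  have h : (7 : ℝ) ≤ n := by exact_mod_cast hn
  have h1 : (0 : ℝ) < (n : ℝ) - 6 := by linarith
  have h2 : (0 : ℝ) < (n : ℝ) ^ 4 - 20 * (n : ℝ) ^ 2 + 64 := by
    have h3 : (49 : ℝ) ≤ (n : ℝ) ^ 2 := by nlinarith
    nlinarith
  unfold cN
  positivity

/-- The difference of two solutions, written as a chain. -/
lemma factorChain_sub {n : ℕ} (hn : 7 ≤ n) {v₁ v₂ : ℝ → ℝ} (hv₁ : IsSolO6 n v₁)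
    (hv₂ : IsSolO6 n v₂) :
    ∃ x, FactorChain (rates (((n : ℝ) - 6) / 2) (((n : ℝ) - 2) / 2) (((n : ℝ) + 2) / 2)) x ∧
      (∀ t, x 0 t = v₁ t - v₂ t) ∧ (∃ A, ∀ t, x 1 t = deriv v₁ t - deriv v₂ t - A * x 0 t) ∧
      ∀ t, x 6 t = -cN n * (|v₁ t| ^ (12 / ((n : ℝ) - 6)) * v₁ t -
        |v₂ t| ^ (12 / ((n : ℝ) - 6)) * v₂ t) := by
  set α := rates (((n : ℝ) - 6) / 2) (((n : ℝ) - 2) / 2) (((n : ℝ) + 2) / 2) with hα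
  let D : ℕ → ℝ → ℝ := fun j t => iteratedDeriv j v₁ t - iteratedDeriv j v₂ t
  have hv : ∀ {v : ℝ → ℝ}, ContDiff ℝ 6 v → ∀ j < 6, ∀ t,
      HasDerivAt (iteratedDeriv j v) (iteratedDeriv (j + 1) v t) t := by
    intro v hc j hj t
    rw [iteratedDeriv_succ]
    exact (hc.differentiable_iteratedDeriv j (by exact_mod_cast hj) t).hasDerivAt
  have hD : ∀ j < 6, ∀ t, HasDerivAt (D j) (D (j + 1) t) t := fun j hj t =>
    (hv hv₁.1 j hj t).sub (hv hv₂.1 j hj t)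
  have h6 : ∀ t, factored α D 6 0 t = -cN n * (|v₁ t| ^ (12 / ((n : ℝ) - 6)) * v₁ t -
      |v₂ t| ^ (12 / ((n : ℝ) - 6)) * v₂ t) := by
    intro t
    have e₁ := hv₁.2 t
    have e₂ := hv₂.2 t
    rw [hα, factored_rates_six]
    simp only [D, iteratedDeriv_zero]
    unfold K0 K2 K4 at e₁ e₂
    linear_combination e₁ - e₂
  have hp : 0 < 12 / ((n : ℝ) - 6) := by
    have h : (7 : ℝ) ≤ n := by exact_mod_cast hn
    exact div_pos (by norm_num) (by linarith)
  have hmono := abs_rpow_mul_self_strictMono hp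
  have hc := cN_pos hn
  have hx0 : ∀ t, factored α D 0 0 t = v₁ t - v₂ t := fun t => by simp [factored, D]
  refine ⟨fun k => factored α D k 0, ⟨fun k hk t => ?_, fun t ht => ?_, fun t ht => ?_⟩, hx0,
    ⟨α 0, fun t => by simp [factored, D]⟩, h6⟩
  · exact (hasDerivAt_factored hD k 0 (by omega) t).congr_deriv (by simp [factored])
  · rw [hx0] at ht
    have := hmono (sub_pos.1 ht)
    rw [h6]
    nlinarith
  · rw [hx0] at ht
    have := hmono (sub_neg.1 ht)
    rw [h6]
    nlinarith

theorem bounded_solutions_determined_by_two_initial_values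
    (n : ℕ) (hn : 7 ≤ n) (v₁ v₂ : ℝ → ℝ)
    (hv₁ : IsSolO6 n v₁) (hv₂ : IsSolO6 n v₂)
    (hb₁ : ∃ M : ℝ, ∀ t : ℝ, |v₁ t| ≤ M) (hb₂ : ∃ M : ℝ, ∀ t : ℝ, |v₂ t| ≤ M)
    (h0 : v₁ 0 = v₂ 0) (h1 : deriv v₁ 0 = deriv v₂ 0) :
    ∀ t : ℝ, v₁ t = v₂ t := by
  obtain ⟨M₁, hM₁⟩ := hb₁
  obtain ⟨M₂, hM₂⟩ := hb₂
  obtain ⟨x, hx, hx0, ⟨A, hx1⟩, hx6⟩ := factorChain_sub hn hv₁ hv₂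
  have h : (7 : ℝ) ≤ n := by exact_mod_cast hn
  have hp : 0 < 12 / ((n : ℝ) - 6) := div_pos (by norm_num) (by linarith)
  have hx00 : x 0 0 = 0 := by rw [hx0, h0, sub_self]
  intro t
  have hzero := hx.eq_zero (M := M₁ + M₂)
    (L := cN n * ((12 / ((n : ℝ) - 6) + 1) * (max M₁ M₂) ^ (12 / ((n : ℝ) - 6))))
    (by linarith) (by linarith) (by linarith)
    (fun t => by
      rw [hx0]
      exact (abs_sub _ _).trans (add_le_add (hM₁ t) (hM₂ t)))
    (fun t => by
      rw [hx6, hx0, abs_mul, abs_neg, abs_of_pos (cN_pos hn), mul_assoc]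
      exact mul_le_mul_of_nonneg_left (abs_abs_rpow_mul_self_sub_le hp
        ((hM₁ t).trans (le_max_left _ _)) ((hM₂ t).trans (le_max_right _ _))) (cN_pos hn).le)
    hx00 (by rw [hx1, hx00, h1]; ring) t
  rw [hx0] at hzero
  linarith
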